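/- arXiv:2006.08643 — 7 statements merged into one kernel-verified Lean document; each statement's English description precedes it below -/
import Mathlib

section
/- Consider N smooth model functions f₁, …, f_N : ℝ^p → ℝ, each k-homogeneous (k a natural number with k ≥ 1), differentiable sample losses ℓ₁, …, ℓ_N : ℝ → ℝ, a real λ, and the total loss L(θ) = Σ_{i=1}^N ℓ_i(f_i(θ)) + (λ/2)‖θ‖². Let θ : ℝ → ℝ^p be a differentiable gradient-flow trajectory, i.e. dθ/dt = -∇L(θ(t)) for all t. Then for every index j and every time t, d/dt [f_j(θ(t))] = - Σ_{i=1}^N Θ_t(j,i) * ℓ_i'(f_i(θ(t))) - k * λ * f_j(θ(t)), where Θ_t(j,i) = ⟨∇f_j(θ(t)), ∇f_i(θ(t))⟩ is the Neural Tangent Kernel at time t. -/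
open RealInnerProductSpace

section

variable {E : Type*} [NormedAddCommGroup E] [InnerProductSpace ℝ E]

/-- Euler's identity for positively homogeneous functions. -/
theorem fderiv_apply_self_of_homogeneous {f : E → ℝ} {k : ℕ} {x : E}
    (hf : DifferentiableAt ℝ f x)
    (hhom : ∀ a : ℝ, 0 < a → f (a • x) = a ^ k * f x) :
    fderiv ℝ f x x = k * f x := by
  have hray : HasDerivAt (fun a : ℝ => a • x) x 1 := by
    simpa using (hasDerivAt_id (1 : ℝ)).smul_const x
  have hleft : HasDerivAt (fun a : ℝ => f (a • x)) (fderiv ℝ f x x) 1 :=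
    hf.hasFDerivAt.comp_hasDerivAt_of_eq 1 hray (one_smul ℝ x).symm
  have hright : HasDerivAt (fun a : ℝ => a ^ k * f x) (k * f x) 1 := by
    simpa using (hasDerivAt_pow k (1 : ℝ)).mul_const (f x)
  have heq : (fun a : ℝ => f (a • x)) =ᶠ[nhds 1] fun a => a ^ k * f x := by
    filter_upwards [lt_mem_nhds (zero_lt_one' ℝ)] with a ha using hhom a ha
  exact (hleft.congr_of_eventuallyEq heq.symm).unique hright

/-- The gradient of an `L2`-regularized sum of sample losses. -/
theorem hasGradientAt_regularized_loss [CompleteSpace E] {ι : Type*} [Fintype ι]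
    {f : ι → E → ℝ} {ℓ : ι → ℝ → ℝ} {x : E} (c : ℝ)
    (hf : ∀ i, DifferentiableAt ℝ (f i) x) (hℓ : ∀ i, DifferentiableAt ℝ (ℓ i) (f i x)) :
    HasGradientAt (fun y => (∑ i, ℓ i (f i y)) + c / 2 * ‖y‖ ^ 2)
      ((∑ i, deriv (ℓ i) (f i x) • gradient (f i) x) + c • x) x := by
  rw [hasGradientAt_iff_hasFDerivAt]
  have hsum : HasFDerivAt (fun y => ∑ i, ℓ i (f i y))
      (∑ i, deriv (ℓ i) (f i x) • fderiv ℝ (f i) x) x :=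
    HasFDerivAt.fun_sum fun i _ =>
      (hℓ i).hasDerivAt.comp_hasFDerivAt x (hf i).hasFDerivAt
  have hnorm : HasFDerivAt (fun y : E => c / 2 * ‖y‖ ^ 2)
      ((c / 2) • (2 • innerSL ℝ x)) x :=
    (hasStrictFDerivAt_norm_sq x).hasFDerivAt.const_mul (c / 2)
  refine (hsum.add hnorm).congr_fderiv ?_
  ext v
  simp
  ring

end

/-- Gradient-flow evolution of the outputs of a `k`-homogeneous model trained with
`L2` regularization: `d/dt f_j(θ(t)) = -∑ᵢ Θ_t(j,i) ℓᵢ'(fᵢ(θ(t))) - kλ f_j(θ(t))`,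
where `Θ_t(j,i) = ⟪∇f_j(θ(t)), ∇f_i(θ(t))⟫` is the Neural Tangent Kernel. -/
theorem gradient_flow_function_evolution
    (p N : ℕ) (hp : 0 < p) (k : ℕ) (hk : 1 ≤ k)
    (f : Fin N → EuclideanSpace ℝ (Fin p) → ℝ)
    (hf : ∀ i, ContDiff ℝ (⊤ : ℕ∞) (f i))
    (hhom : ∀ i (a : ℝ), 0 < a → ∀ θ : EuclideanSpace ℝ (Fin p),
      f i (a • θ) = a ^ k * f i θ)
    (ℓ : Fin N → ℝ → ℝ) (hℓ : ∀ i, Differentiable ℝ (ℓ i))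
    (lam : ℝ)
    (L : EuclideanSpace ℝ (Fin p) → ℝ)
    (hL : L = fun θ => (∑ i, ℓ i (f i θ)) + lam / 2 * ‖θ‖ ^ 2)
    (θ : ℝ → EuclideanSpace ℝ (Fin p))
    (hθ : ∀ t, HasDerivAt θ (-(gradient L (θ t))) t) :
    ∀ (j : Fin N) (t : ℝ),
      HasDerivAt (fun s => f j (θ s))
        (-(∑ i, ⟪gradient (f j) (θ t), gradient (f i) (θ t)⟫ *
              deriv (ℓ i) (f i (θ t)))
          - (k : ℝ) * lam * f j (θ t)) t := by
  intro j t
  have hdiff : ∀ i, DifferentiableAt ℝ (f i) (θ t) := fun i =>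
    (hf i).differentiable (by simp) (θ t)
  have hgrad : gradient L (θ t) =
      (∑ i, deriv (ℓ i) (f i (θ t)) • gradient (f i) (θ t)) + lam • θ t := by
    rw [hL]
    exact (hasGradientAt_regularized_loss lam hdiff fun i => hℓ i _).gradient
  have heuler : ⟪gradient (f j) (θ t), θ t⟫ = k * f j (θ t) := by
    rw [inner_gradient_left]
    exact fderiv_apply_self_of_homogeneous (hdiff j) fun a ha => hhom j a ha (θ t)
  refine ((hdiff j).hasFDerivAt.comp_hasDerivAt t (hθ t)).congr_deriv ?_
  rw [← inner_gradient_left, hgrad, inner_neg_right, inner_add_right, inner_sum,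
    real_inner_smul_right, heuler]
  simp only [real_inner_smul_right, mul_comm (deriv _ _)]
  ring
end

section
/- Consider N smooth model functions f₁, …, f_N : ℝ^p → ℝ, each k-homogeneous (k a natural number), differentiable sample losses ℓ₁, …, ℓ_N : ℝ → ℝ, a real λ, the total loss L(θ) = Σ_{i=1}^N ℓ_i(f_i(θ)) + (λ/2)‖θ‖², and a differentiable gradient-flow trajectory θ : ℝ → ℝ^p with dθ/dt = -∇L(θ(t)). Then for every natural number m, every index j, all fixed direction vectors v₁, …, v_m ∈ ℝ^p, and every time t, d/dt [ D^m f_j(θ(t))[v₁, …, v_m] ] = - Σ_{i=1}^N ℓ_i'(f_i(θ(t))) * D^{m+1} f_j(θ(t))[∇f_i(θ(t)), v₁, …, v_m] - (k - m) * λ * D^m f_j(θ(t))[v₁, …, v_m]. -/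
open RealInnerProductSpace

/-- Chain rule for an iterated derivative, with fixed directions, along a curve. -/
theorem HasDerivAt.iteratedFDeriv_apply_comp {E F : Type*} [NormedAddCommGroup E]
    [NormedSpace ℝ E] [NormedAddCommGroup F] [NormedSpace ℝ F] {f : E → F} {m : ℕ} {n : WithTop ℕ∞}
    (hf : ContDiff ℝ n f) (hm : (m : WithTop ℕ∞) < n) {γ : ℝ → E} {γ' : E} {t : ℝ}
    (hγ : HasDerivAt γ γ' t) (v : Fin m → E) :
    HasDerivAt (fun s => iteratedFDeriv ℝ m f (γ s) v)
      (iteratedFDeriv ℝ (m + 1) f (γ t) (Fin.cons γ' v)) t := by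
  have h := ((hf.differentiable_iteratedFDeriv hm) (γ t)).hasFDerivAt.comp_hasDerivAt t hγ
  exact (ContinuousMultilinearMap.apply ℝ (fun _ : Fin m => E) F v).hasFDerivAt.comp_hasDerivAt t h

/-- The `m`-th derivative of a positively `k`-homogeneous function is homogeneous of
degree `k - m`. -/
theorem iteratedFDeriv_smul_of_homogeneous {E : Type*} [NormedAddCommGroup E] [NormedSpace ℝ E]
    {f : E → ℝ} {m k : ℕ} (hf : ContDiff ℝ m f)
    (hhom : ∀ a : ℝ, 0 < a → ∀ x, f (a • x) = a ^ k * f x) {a : ℝ} (ha : 0 < a) (x : E) :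
    a ^ m • iteratedFDeriv ℝ m f (a • x) = a ^ k • iteratedFDeriv ℝ m f x := by
  have hfun : (fun y => f (a • y)) = a ^ k • f := funext fun y => by simp [hhom a ha y]
  rw [← iteratedFDeriv_const_smul_apply (a := a ^ k) hf.contDiffAt, ← hfun,
    iteratedFDeriv_comp_const_smul a hf]

/-- Euler's identity for the `m`-th derivative of a positively `k`-homogeneous function. -/
theorem iteratedFDeriv_succ_cons_self_of_homogeneous {E : Type*} [NormedAddCommGroup E]
    [NormedSpace ℝ E] {f : E → ℝ} {m k : ℕ} {n : WithTop ℕ∞} (hf : ContDiff ℝ n f)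
    (hm : (m : WithTop ℕ∞) < n) (hhom : ∀ a : ℝ, 0 < a → ∀ x, f (a • x) = a ^ k * f x)
    (x : E) (v : Fin m → E) :
    iteratedFDeriv ℝ (m + 1) f x (Fin.cons x v) =
      ((k : ℝ) - m) * iteratedFDeriv ℝ m f x v := by
  have hγ : HasDerivAt (fun a : ℝ => a • x) x 1 := by
    simpa using (hasDerivAt_id (1 : ℝ)).smul_const x
  have hleft := ((hasDerivAt_id (1 : ℝ)).pow m).mul (hγ.iteratedFDeriv_apply_comp hf hm v)
  have hright := ((hasDerivAt_id (1 : ℝ)).pow k).mul_const (iteratedFDeriv ℝ m f x v)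
  have heq : (fun a : ℝ => a ^ m * iteratedFDeriv ℝ m f (a • x) v) =ᶠ[nhds 1]
      fun a => a ^ k * iteratedFDeriv ℝ m f x v := by
    filter_upwards [eventually_gt_nhds (zero_lt_one' ℝ)] with a ha
    simpa using
      DFunLike.congr_fun (iteratedFDeriv_smul_of_homogeneous (hf.of_le hm.le) hhom ha x) v
  have h := hleft.unique (hright.congr_of_eventuallyEq heq)
  simp at h
  linarith

/-- Gradient of an `L2`-regularized sum of losses. -/
theorem hasGradientAt_sum_comp_add_norm_sq {E ι : Type*} [NormedAddCommGroup E]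
    [InnerProductSpace ℝ E] [CompleteSpace E] [Fintype ι] {f : ι → E → ℝ} {ℓ : ι → ℝ → ℝ} {x : E}
    (hf : ∀ i, DifferentiableAt ℝ (f i) x) (hℓ : ∀ i, DifferentiableAt ℝ (ℓ i) (f i x))
    (c : ℝ) :
    HasGradientAt (fun y => (∑ i, ℓ i (f i y)) + c / 2 * ‖y‖ ^ 2)
      ((∑ i, deriv (ℓ i) (f i x) • gradient (f i) x) + c • x) x := by
  have hsum := HasFDerivAt.fun_sum (u := Finset.univ) fun i _ =>
    (hℓ i).hasDerivAt.comp_hasFDerivAt x (hf i).hasGradientAt.hasFDerivAt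
  have hnorm := (hasStrictFDerivAt_norm_sq x).hasFDerivAt.const_mul (c / 2)
  rw [hasGradientAt_iff_hasFDerivAt]
  refine (hsum.add hnorm).congr_fderiv ?_
  ext y
  simp
  ring

/-- Gradient-flow evolution of the iterated derivative tensors of a `k`-homogeneous model
trained with `L2` regularization:
`d/dt D^m f_j(θ(t))[v] = -∑ᵢ ℓᵢ'(fᵢ(θ(t))) D^{m+1} f_j(θ(t))[∇fᵢ(θ(t)), v] - (k-m)λ D^m f_j(θ(t))[v]`. -/
theorem gradient_flow_derivative_tensor_evolution
    (p N : ℕ) (hp : 0 < p) (k : ℕ)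
    (f : Fin N → EuclideanSpace ℝ (Fin p) → ℝ)
    (hf : ∀ i, ContDiff ℝ (⊤ : ℕ∞) (f i))
    (hhom : ∀ i (a : ℝ), 0 < a → ∀ θ : EuclideanSpace ℝ (Fin p),
      f i (a • θ) = a ^ k * f i θ)
    (ℓ : Fin N → ℝ → ℝ) (hℓ : ∀ i, Differentiable ℝ (ℓ i))
    (lam : ℝ)
    (L : EuclideanSpace ℝ (Fin p) → ℝ)
    (hL : L = fun θ => (∑ i, ℓ i (f i θ)) + lam / 2 * ‖θ‖ ^ 2)
    (θ : ℝ → EuclideanSpace ℝ (Fin p))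
    (hθ : ∀ t, HasDerivAt θ (-(gradient L (θ t))) t) :
    ∀ (m : ℕ) (j : Fin N) (v : Fin m → EuclideanSpace ℝ (Fin p)) (t : ℝ),
      HasDerivAt (fun s => iteratedFDeriv ℝ m (f j) (θ s) v)
        (-(∑ i, deriv (ℓ i) (f i (θ t)) *
              iteratedFDeriv ℝ (m + 1) (f j) (θ t) (Fin.cons (gradient (f i) (θ t)) v))
          - ((k : ℝ) - (m : ℝ)) * lam * iteratedFDeriv ℝ m (f j) (θ t) v) t := by
  intro m j v t
  have hdiff (i : Fin N) : Differentiable ℝ (f i) := (hf i).differentiable (by simp)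
  have hm : (m : WithTop ℕ∞) < ((⊤ : ℕ∞) : WithTop ℕ∞) := by
    exact_mod_cast ENat.natCast_lt_top m
  have hgrad : gradient L (θ t) =
      (∑ i, deriv (ℓ i) (f i (θ t)) • gradient (f i) (θ t)) + lam • θ t := by
    rw [hL]
    exact (hasGradientAt_sum_comp_add_norm_sq (fun i => hdiff i (θ t))
      (fun i => hℓ i (f i (θ t))) lam).gradient
  refine ((hθ t).iteratedFDeriv_apply_comp (hf j) hm v).congr_deriv ?_
  have heuler := iteratedFDeriv_succ_cons_self_of_homogeneous (hf j) hm (hhom j) (θ t) v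
  simp only [iteratedFDeriv_succ_apply_left, Fin.cons_zero, Fin.tail_cons] at heuler ⊢
  simp only [hgrad, map_neg, map_add, map_sum, map_smul, neg_apply,
    add_apply, sum_apply,
    smul_apply, smul_eq_mul, heuler]
  ring
end

section
/- Consider N smooth model functions f₁, …, f_N : ℝ^p → ℝ, each k-homogeneous (k a natural number with k ≥ 1), differentiable sample losses ℓ₁, …, ℓ_N : ℝ → ℝ, a real λ, the total loss L(θ) = Σ_{i=1}^N ℓ_i(f_i(θ)) + (λ/2)‖θ‖², and a differentiable gradient-flow trajectory θ : ℝ → ℝ^p with dθ/dt = -∇L(θ(t)). Define Θ_t(i,j) = ⟨∇f_i(θ(t)), ∇f_j(θ(t))⟩ and T_t(i,j) = - Σ_{r=1}^N ℓ_r'(f_r(θ(t))) * D²f_i(θ(t))[∇f_j(θ(t)), ∇f_r(θ(t))], where D²f_i(θ) is the Hessian bilinear form of f_i at θ. Then for all indices i, j and every time t, d/dt [Θ_t(i,j)] = -2(k-1) * λ * Θ_t(i,j) + T_t(i,j) + T_t(j,i). -/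
open RealInnerProductSpace

/-- Euler's identity for positively homogeneous maps. -/
theorem fderiv_apply_self_of_homogeneous_s3 {E F : Type*} [NormedAddCommGroup E] [NormedSpace ℝ E]
    [NormedAddCommGroup F] [NormedSpace ℝ F] {g : E → F} {n : ℕ} {x : E}
    (hg : DifferentiableAt ℝ g x) (hhom : ∀ a : ℝ, 0 < a → g (a • x) = a ^ n • g x) :
    fderiv ℝ g x x = (n : ℝ) • g x := by
  have hline : HasDerivAt (fun a : ℝ => a • x) x 1 := by
    simpa using (hasDerivAt_id (1 : ℝ)).smul_const x
  have hcomp : HasDerivAt (fun a : ℝ => g (a • x)) (fderiv ℝ g x x) 1 := by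
    have h : HasFDerivAt g (fderiv ℝ g x) ((1 : ℝ) • x) := by
      simpa using hg.hasFDerivAt
    exact h.comp_hasDerivAt 1 hline
  have hpow : HasDerivAt (fun a : ℝ => a ^ n • g x) ((n : ℝ) • g x) 1 := by
    simpa using (hasDerivAt_pow n (1 : ℝ)).smul_const (g x)
  refine hcomp.unique (hpow.congr_of_eventuallyEq ?_)
  filter_upwards [lt_mem_nhds one_pos] with a ha using hhom a ha

/-- The derivative of a `k`-homogeneous map is `(k - 1)`-homogeneous. -/
theorem fderiv_smul_of_homogeneous {E F : Type*} [NormedAddCommGroup E] [NormedSpace ℝ E]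
    [NormedAddCommGroup F] [NormedSpace ℝ F] {g : E → F} {k : ℕ} (hk : 1 ≤ k)
    (hg : Differentiable ℝ g) {a : ℝ} (ha : a ≠ 0) (hhom : ∀ x, g (a • x) = a ^ k • g x) (x : E) :
    fderiv ℝ g (a • x) = a ^ (k - 1) • fderiv ℝ g x := by
  have h : a • fderiv ℝ g (a • x) = a ^ k • fderiv ℝ g x := by
    rw [← fderiv_comp_smul, ← fderiv_const_smul (hg x)]
    exact congrArg (fun u => fderiv ℝ u x) (funext hhom)
  apply smul_right_injective _ ha
  simp only [h, smul_smul]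
  rw [← pow_succ', Nat.sub_add_cancel hk]

/-- The Hessian of a `k`-homogeneous function, applied to the base point. -/
theorem fderiv_fderiv_apply_self_of_homogeneous {E F : Type*} [NormedAddCommGroup E]
    [NormedSpace ℝ E] [NormedAddCommGroup F] [NormedSpace ℝ F] {g : E → F} {k : ℕ} (hk : 1 ≤ k)
    (hg : ContDiff ℝ 2 g) (hhom : ∀ a : ℝ, 0 < a → ∀ x, g (a • x) = a ^ k • g x) (x : E) :
    fderiv ℝ (fderiv ℝ g) x x = ((k : ℝ) - 1) • fderiv ℝ g x := by
  have hdiff : Differentiable ℝ (fderiv ℝ g) :=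
    (hg.fderiv_right (m := 1) (by norm_num)).differentiable (by norm_num)
  rw [fderiv_apply_self_of_homogeneous_s3 (n := k - 1) (hdiff x), Nat.cast_sub hk, Nat.cast_one]
  exact fun a ha =>
    fderiv_smul_of_homogeneous hk (hg.differentiable (by norm_num)) ha.ne' (hhom a ha) x

/-- The gradient of a sum of losses with an `L2` regularization term. -/
theorem gradient_sum_comp_add_sq_norm {E ι : Type*} [NormedAddCommGroup E] [InnerProductSpace ℝ E]
    [CompleteSpace E] [Fintype ι] {f : ι → E → ℝ} {l : ι → ℝ → ℝ} {x : E}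
    (hf : ∀ i, DifferentiableAt ℝ (f i) x) (hl : ∀ i, DifferentiableAt ℝ (l i) (f i x)) (c : ℝ) :
    gradient (fun y => (∑ i, l i (f i y)) + c / 2 * ‖y‖ ^ 2) x =
      (∑ i, deriv (l i) (f i x) • gradient (f i) x) + c • x := by
  apply HasGradientAt.gradient
  have hsum : HasFDerivAt (fun y => ∑ i, l i (f i y))
      (∑ i, deriv (l i) (f i x) • fderiv ℝ (f i) x) x :=
    HasFDerivAt.fun_sum fun i _ => (hl i).hasDerivAt.comp_hasFDerivAt x (hf i).hasFDerivAt
  have hsq := ((hasStrictFDerivAt_norm_sq x).hasFDerivAt).const_mul (c / 2)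
  rw [hasGradientAt_iff_hasFDerivAt]
  refine (hsum.add hsq).congr_fderiv ?_
  ext v
  simp [gradient]
  ring

/-- The derivative of the inner product of two gradients along a curve. -/
theorem HasDerivAt.inner_gradient {E : Type*} [NormedAddCommGroup E] [InnerProductSpace ℝ E]
    [CompleteSpace E] {f g : E → ℝ} (hf : ContDiff ℝ 2 f) (hg : ContDiff ℝ 2 g)
    {γ : ℝ → E} {v : E} {t : ℝ} (hγ : HasDerivAt γ v t) :
    HasDerivAt (fun s => ⟪gradient f (γ s), gradient g (γ s)⟫)
      (fderiv ℝ (fderiv ℝ f) (γ t) v (gradient g (γ t)) +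
        fderiv ℝ (fderiv ℝ g) (γ t) v (gradient f (γ t))) t := by
  have hgrad : ∀ {h : E → ℝ}, ContDiff ℝ 2 h → HasDerivAt (fun s => gradient h (γ s))
      ((InnerProductSpace.toDual ℝ E).symm (fderiv ℝ (fderiv ℝ h) (γ t) v)) t := by
    intro h hh
    have hdiff : Differentiable ℝ (fderiv ℝ h) :=
      (hh.fderiv_right (m := 1) (by norm_num)).differentiable (by norm_num)
    exact ((InnerProductSpace.toDual ℝ E).symm.toContinuousLinearEquiv.toContinuousLinearMap
      |>.hasFDerivAt.comp_hasDerivAt t ((hdiff (γ t)).hasFDerivAt.comp_hasDerivAt t hγ))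
  refine ((hgrad hf).inner ℝ (hgrad hg)).congr_deriv ?_
  rw [real_inner_comm, InnerProductSpace.toDual_symm_apply, InnerProductSpace.toDual_symm_apply,
    add_comm]

/-- Gradient-flow evolution of the Neural Tangent Kernel of a `k`-homogeneous model trained
with `L2` regularization: `d/dt Θ_t(i,j) = -2(k-1)λ Θ_t(i,j) + T_t(i,j) + T_t(j,i)`, where
`T_t(i,j) = -∑ᵣ ℓᵣ'(fᵣ(θ(t))) D²f_i(θ(t))[∇f_j(θ(t)), ∇fᵣ(θ(t))]`. -/
theorem gradient_flow_ntk_evolution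
    (p N : ℕ) (hp : 0 < p) (k : ℕ) (hk : 1 ≤ k)
    (f : Fin N → EuclideanSpace ℝ (Fin p) → ℝ)
    (hf : ∀ i, ContDiff ℝ (⊤ : ℕ∞) (f i))
    (hhom : ∀ i (a : ℝ), 0 < a → ∀ θ : EuclideanSpace ℝ (Fin p),
      f i (a • θ) = a ^ k * f i θ)
    (ℓ : Fin N → ℝ → ℝ) (hℓ : ∀ i, Differentiable ℝ (ℓ i))
    (lam : ℝ)
    (L : EuclideanSpace ℝ (Fin p) → ℝ)
    (hL : L = fun θ => (∑ i, ℓ i (f i θ)) + lam / 2 * ‖θ‖ ^ 2)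
    (θ : ℝ → EuclideanSpace ℝ (Fin p))
    (hθ : ∀ t, HasDerivAt θ (-(gradient L (θ t))) t)
    (Θ : ℝ → Fin N → Fin N → ℝ)
    (hΘ : ∀ t i j, Θ t i j = ⟪gradient (f i) (θ t), gradient (f j) (θ t)⟫)
    (T : ℝ → Fin N → Fin N → ℝ)
    (hT : ∀ t i j, T t i j =
      -(∑ r, deriv (ℓ r) (f r (θ t)) *
          iteratedFDeriv ℝ 2 (f i) (θ t) ![gradient (f j) (θ t), gradient (f r) (θ t)])) :
    ∀ (i j : Fin N) (t : ℝ),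
      HasDerivAt (fun s => Θ s i j)
        (-2 * ((k : ℝ) - 1) * lam * Θ t i j + T t i j + T t j i) t := by
  intro i j t
  have hC2 : ∀ i, ContDiff ℝ 2 (f i) := fun i => contDiff_infty.mp (hf i) 2
  have hgradL : gradient L (θ t) =
      (∑ r, deriv (ℓ r) (f r (θ t)) • gradient (f r) (θ t)) + lam • θ t := by
    rw [hL]
    exact gradient_sum_comp_add_sq_norm
      (fun r => (hC2 r).differentiable (by norm_num) _) (fun r => hℓ r _) lam
  have hess : ∀ i j, fderiv ℝ (fderiv ℝ (f i)) (θ t) (-(gradient L (θ t)))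
      (gradient (f j) (θ t)) = T t i j - ((k : ℝ) - 1) * lam * Θ t i j := by
    intro i j
    have hsymm : IsSymmSndFDerivAt ℝ (f i) (θ t) :=
      (hC2 i).contDiffAt.isSymmSndFDerivAt (by simp)
    have hself := fderiv_fderiv_apply_self_of_homogeneous hk (hC2 i)
      (fun a ha x => hhom i a ha x) (θ t)
    have hinner : fderiv ℝ (f i) (θ t) (gradient (f j) (θ t)) = Θ t i j := by
      rw [hΘ]
      exact (InnerProductSpace.toDual_symm_apply).symm
    rw [hgradL, hT]
    simp only [map_neg, map_add, map_sum, map_smul, hself, neg_apply,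
      add_apply, sum_apply,
      smul_apply, smul_eq_mul, hinner, iteratedFDeriv_two_apply,
      Matrix.cons_val_zero, Matrix.cons_val_one]
    simp only [hsymm.eq (gradient (f j) (θ t))]
    ring
  simp only [hΘ _ i j]
  refine ((hθ t).inner_gradient (hC2 i) (hC2 j)).congr_deriv ?_
  have hcomm : Θ t j i = Θ t i j := by rw [hΘ, hΘ, real_inner_comm]
  rw [hess i j, hess j i, hcomm, ← hΘ]
  ring
end

section
/- Let k be a natural number with k ≥ 2, λ > 0 a real number, and γ, y, f₀ real numbers. Define γ(t) = γ * exp(-2(k-1)λt) and g : ℝ → ℝ by g(t) = exp( γ(t)/(2(k-1)λ) - kλt ) * ( exp( -γ/(2(k-1)λ) ) * f₀ + γ * y * ∫₀ᵗ exp( -γ(s)/(2(k-1)λ) - (k-2)λs ) ds ). Then g(0) = f₀ and g is differentiable with g'(t) = -γ(t) * (g(t) - y) - kλ * g(t) for every real t; that is, g solves the gradient-flow mode equation of an infinitely wide k-homogeneous network trained with MSE loss and L2 regularization. -/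
/-- The explicit mode solution of an infinitely wide `k`-homogeneous network trained with
MSE loss and `L2` regularization: `g` satisfies `g(0) = f₀` and
`g'(t) = -γ(t) (g(t) - y) - kλ g(t)` where `γ(t) = γ e^{-2(k-1)λt}`. -/
theorem mse_mode_solution
    (k : ℕ) (hk : 2 ≤ k) (lam : ℝ) (hlam : 0 < lam) (γ y f₀ : ℝ)
    (γt : ℝ → ℝ) (hγt : γt = fun t => γ * Real.exp (-2 * ((k : ℝ) - 1) * lam * t))
    (g : ℝ → ℝ)
    (hg : g = fun t =>
      Real.exp (γt t / (2 * ((k : ℝ) - 1) * lam) - (k : ℝ) * lam * t) *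
        (Real.exp (-γ / (2 * ((k : ℝ) - 1) * lam)) * f₀ +
          γ * y * ∫ s in (0:ℝ)..t,
            Real.exp (-γt s / (2 * ((k : ℝ) - 1) * lam) - ((k : ℝ) - 2) * lam * s))) :
    g 0 = f₀ ∧
      ∀ t : ℝ, HasDerivAt g (-(γt t) * (g t - y) - (k : ℝ) * lam * g t) t := by
  have hk' : (2 : ℝ) ≤ k := by exact_mod_cast hk
  have hc : 2 * ((k : ℝ) - 1) * lam ≠ 0 :=
    mul_ne_zero (mul_ne_zero two_ne_zero (by linarith)) hlam.ne'
  have hdγ : ∀ t, HasDerivAt γt (-(2 * ((k : ℝ) - 1) * lam) * γt t) t := by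
    intro t
    rw [hγt]
    refine ((((hasDerivAt_id t).const_mul (-2 * ((k : ℝ) - 1) * lam)).exp).const_mul γ).congr_deriv ?_
    simp only [id]
    ring
  have hγ0 : γt 0 = γ := by simp [hγt]
  have hγexp : ∀ t, γt t = γ * Real.exp (-2 * ((k : ℝ) - 1) * lam * t) := fun t => by rw [hγt]
  clear hγt
  have hcγ : Continuous γt := continuous_iff_continuousAt.2 fun t => (hdγ t).continuousAt
  subst hg
  refine ⟨?_, fun t => ?_⟩
  · simp only [hγ0, intervalIntegral.integral_same, mul_zero, sub_zero, add_zero]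
    rw [← mul_assoc, ← Real.exp_add, neg_div, add_neg_cancel, Real.exp_zero, one_mul]
  · have hci : Continuous fun s => Real.exp (-γt s / (2 * ((k : ℝ) - 1) * lam)
        - ((k : ℝ) - 2) * lam * s) := by fun_prop
    have hint := hci.integral_hasStrictDerivAt 0 t |>.hasDerivAt
    have hpre := (((hdγ t).div_const (2 * ((k : ℝ) - 1) * lam)).sub
      ((hasDerivAt_id t).const_mul ((k : ℝ) * lam))).exp
    have hsource : Real.exp (γt t / (2 * ((k : ℝ) - 1) * lam) - (k : ℝ) * lam * t) *
        Real.exp (-γt t / (2 * ((k : ℝ) - 1) * lam) - ((k : ℝ) - 2) * lam * t) =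
        Real.exp (-2 * ((k : ℝ) - 1) * lam * t) := by
      rw [← Real.exp_add]
      congr 1
      ring
    have hrate : -(2 * ((k : ℝ) - 1) * lam) * γt t / (2 * ((k : ℝ) - 1) * lam) = -γt t := by
      rw [neg_mul, neg_div, mul_div_cancel_left₀ _ hc]
    refine (hpre.mul ((hint.const_mul (γ * y)).const_add
      (Real.exp (-γ / (2 * ((k : ℝ) - 1) * lam)) * f₀))).congr_deriv ?_
    simp only [Pi.sub_apply, id, hrate]
    linear_combination (γ * y) * hsource - y * hγexp t
end

section
/- Let k be a natural number with k ≥ 2, λ > 0 a real number, γ ≥ 0, and y, f₀ real numbers. Define γ(t) = γ * exp(-2(k-1)λt) and g(t) = exp( γ(t)/(2(k-1)λ) - kλt ) * ( exp( -γ/(2(k-1)λ) ) * f₀ + γ * y * ∫₀ᵗ exp( -γ(s)/(2(k-1)λ) - (k-2)λs ) ds ). Then g(t) tends to 0 as t → ∞. -/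
open Filter

theorem tendsto_exp_neg_mul_mul_affine {b : ℝ} (hb : 0 < b) (A B : ℝ) :
    Tendsto (fun t : ℝ => Real.exp (-(b * t)) * (A + B * t)) atTop (nhds 0) := by
  have hbt : Tendsto (fun t : ℝ => b * t) atTop atTop := tendsto_id.const_mul_atTop hb
  have h0 := (Real.tendsto_pow_mul_exp_neg_atTop_nhds_zero 0).comp hbt
  have h1 := (Real.tendsto_pow_mul_exp_neg_atTop_nhds_zero 1).comp hbt
  have h := (h0.const_mul A).add (h1.const_mul (B / b))
  simp only [mul_zero, add_zero] at h
  refine h.congr fun t => ?_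
  simp only [Function.comp_apply, pow_zero, pow_one]
  field_simp

theorem abs_intervalIntegral_exp_le {f : ℝ → ℝ} {t : ℝ} (ht : 0 ≤ t)
    (hf : ∀ s, 0 ≤ s → f s ≤ 0) : |∫ s in (0 : ℝ)..t, Real.exp (f s)| ≤ t := by
  have h := intervalIntegral.norm_integral_le_of_norm_le_const (a := 0) (b := t) (C := 1)
    (f := fun s => Real.exp (f s)) fun s hs => by
      rw [Set.uIoc_of_le ht] at hs
      rw [Real.norm_of_nonneg (Real.exp_pos _).le]
      exact Real.exp_le_one_iff.2 (hf s hs.1.le)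
  simpa [abs_of_nonneg ht] using h

/-- The mode of an infinitely wide `k`-homogeneous network (`k ≥ 2`) trained with MSE loss
and `L2` regularization decays to zero at late times. -/
theorem mse_mode_decays_to_zero
    (k : ℕ) (hk : 2 ≤ k) (lam : ℝ) (hlam : 0 < lam) (γ : ℝ) (hγ : 0 ≤ γ) (y f₀ : ℝ)
    (γt : ℝ → ℝ) (hγt : γt = fun t => γ * Real.exp (-2 * ((k : ℝ) - 1) * lam * t))
    (g : ℝ → ℝ)
    (hg : g = fun t =>
      Real.exp (γt t / (2 * ((k : ℝ) - 1) * lam) - (k : ℝ) * lam * t) *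
        (Real.exp (-γ / (2 * ((k : ℝ) - 1) * lam)) * f₀ +
          γ * y * ∫ s in (0:ℝ)..t,
            Real.exp (-γt s / (2 * ((k : ℝ) - 1) * lam) - ((k : ℝ) - 2) * lam * s))) :
    Tendsto g atTop (nhds 0) := by
  have hk2 : (2 : ℝ) ≤ k := by exact_mod_cast hk
  have hd : 0 < 2 * ((k : ℝ) - 1) * lam := mul_pos (by linarith) hlam
  have hγt_nonneg (s : ℝ) : 0 ≤ γt s := by rw [hγt]; positivity
  have hγt_le (s : ℝ) (hs : 0 ≤ s) : γt s ≤ γ := by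
    rw [hγt]
    exact mul_le_of_le_one_right hγ (Real.exp_le_one_iff.2 (by nlinarith [mul_nonneg hd.le hs]))
  have hlim := (tendsto_exp_neg_mul_mul_affine (b := k * lam) (by positivity)
    |f₀| (γ * |y|)).const_mul (Real.exp (γ / (2 * ((k : ℝ) - 1) * lam)))
  rw [mul_zero] at hlim
  refine squeeze_zero_norm' ?_ hlim
  filter_upwards [eventually_ge_atTop 0] with t ht
  have hint := abs_intervalIntegral_exp_le ht
    (f := fun s => -γt s / (2 * ((k : ℝ) - 1) * lam) - ((k : ℝ) - 2) * lam * s) fun s hs => by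
      have h₁ := div_nonneg (hγt_nonneg s) hd.le
      have h₂ : 0 ≤ ((k : ℝ) - 2) * lam * s :=
        mul_nonneg (mul_nonneg (by linarith) hlam.le) hs
      rw [neg_div]
      linarith
  rw [hg, Real.norm_eq_abs, abs_mul, Real.abs_exp, ← mul_assoc, ← Real.exp_add, ← sub_eq_add_neg]
  refine mul_le_mul ?_ ((abs_add_le _ _).trans (add_le_add ?_ ?_)) (abs_nonneg _)
    (Real.exp_pos _).le
  · have := hγt_le t ht
    gcongr
  · rw [abs_mul, Real.abs_exp]
    refine mul_le_of_le_one_left (abs_nonneg _) (Real.exp_le_one_iff.2 ?_)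
    exact div_nonpos_of_nonpos_of_nonneg (by linarith) hd.le
  · rw [abs_mul, abs_mul, abs_of_nonneg hγ]
    exact mul_le_mul_of_nonneg_left hint (by positivity)
end

section
/- Deep linear network critical-point recursion. Let n, d, L be positive integers with L ≥ 1 and β > 0, λ > 0 reals. Parameters: W⁰ an n×d real matrix, W¹, …, W^{L-1} n×n real matrices, and W^L a 1×n real matrix (row vector); the network function is f(x) = β * (W^L W^{L-1} ⋯ W⁰ x) ∈ ℝ for x ∈ ℝ^d. Given finitely many samples x_s ∈ ℝ^d and differentiable sample losses ℓ_s : ℝ → ℝ, suppose (W⁰, …, W^L) is a critical point of the total loss L_tot = Σ_s ℓ_s(f(x_s)) + (λ/2) Σ_{l=0}^{L} ‖W^l‖_F², i.e. all partial derivatives of L_tot with respect to all matrix entries vanish. Define g = Σ_s ℓ_s'(f(x_s)) • x_s ∈ ℝ^d, the scalar f̃ = -(1/λ) Σ_s ℓ_s'(f(x_s)) * f(x_s), and for 0 ≤ l ≤ L the column vectors Ŵ^{l-1} = -(β/λ) • (W^{l-1} ⋯ W⁰ g) (with the convention Ŵ^{-1} = -(β/λ) • g). Then for every l with 0 ≤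 l ≤ L, the row vector W^L W^{L-1} ⋯ W^l equals f̃^{L-l} • (Ŵ^{l-1})ᵀ. -/
open Matrix

attribute [local instance] Matrix.normedAddCommGroup Matrix.normedSpace

/-- `prodSegDL M l c = M (l+c-1) * ⋯ * M (l+1) * M l`, the ordered product of the
matrices `M l, …, M (l+c-1)` (and `1` when `c = 0`). -/
def prodSegDL {n : ℕ} (M : ℕ → Matrix (Fin n) (Fin n) ℝ) (l : ℕ) :
    ℕ → Matrix (Fin n) (Fin n) ℝ
  | 0 => 1
  | c + 1 => M (l + c) * prodSegDL M l c

/-- Total `L2`-regularized loss of a deep linear network `f(x) = β W^L ⋯ W⁰ x`, with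
`W⁰ = W0`, `W^l = M l` for `1 ≤ l ≤ L-1`, and `W^L` the row vector `wL`. -/
noncomputable def deepLinearLoss (n d L S : ℕ) (β lam : ℝ) (x : Fin S → Fin d → ℝ)
    (ℓ : Fin S → ℝ → ℝ) (W0 : Matrix (Fin n) (Fin d) ℝ)
    (M : ℕ → Matrix (Fin n) (Fin n) ℝ) (wL : Fin n → ℝ) : ℝ :=
  (∑ s, ℓ s (β * (wL ⬝ᵥ (prodSegDL M 1 (L - 1) *ᵥ (W0 *ᵥ x s))))) +
    lam / 2 * ((∑ i, ∑ j, W0 i j ^ 2) +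
      (∑ l ∈ Finset.Icc 1 (L - 1), ∑ i, ∑ j, M l i j ^ 2) + ∑ i, wL i ^ 2)

theorem prodSegDL_add {n : ℕ} (M : ℕ → Matrix (Fin n) (Fin n) ℝ) (l a b : ℕ) :
    prodSegDL M l (a + b) = prodSegDL M (l + a) b * prodSegDL M l a := by
  induction b with
  | zero => simp [prodSegDL]
  | succ b ih => rw [← add_assoc, prodSegDL, ih, prodSegDL, Matrix.mul_assoc, add_assoc]

theorem prodSegDL_congr {n : ℕ} {M N : ℕ → Matrix (Fin n) (Fin n) ℝ} {l c : ℕ}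
    (h : ∀ k, l ≤ k → k < l + c → M k = N k) : prodSegDL M l c = prodSegDL N l c := by
  induction c with
  | zero => rfl
  | succ c ih =>
    rw [prodSegDL, prodSegDL, h (l + c) (by omega) (by omega),
      ih fun k h₁ h₂ => h k h₁ (by omega)]

theorem prodSegDL_update {n : ℕ} (M : ℕ → Matrix (Fin n) (Fin n) ℝ)
    (V : Matrix (Fin n) (Fin n) ℝ) (l a b : ℕ) :
    prodSegDL (Function.update M (l + a) V) l (a + 1 + b) =
      prodSegDL M (l + a + 1) b * V * prodSegDL M l a := by
  rw [prodSegDL_add, prodSegDL, Function.update_self, Matrix.mul_assoc]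
  congr 1
  · exact prodSegDL_congr fun k h₁ h₂ => Function.update_of_ne (by omega) _ _
  · congr 1
    exact prodSegDL_congr fun k h₁ h₂ => Function.update_of_ne (by omega) _ _

/-- Stationarity, in one coordinate, of a sum of differentiable functions of linear forms plus a
quadratic penalty. -/
theorem coord_eq_of_fderiv_regularized_eq_zero {E ι σ : Type*} [NormedAddCommGroup E]
    [NormedSpace ℝ E] [Fintype ι] [DecidableEq ι] [Fintype σ] (φ : ι → E →L[ℝ] ℝ)
    {π : ι → E → ℝ} (hπ : ∀ k V, φ k V = π k V)
    {ℓ : σ → ℝ → ℝ} (hℓ : ∀ s, Differentiable ℝ (ℓ s)) (a : σ → ι → ℝ) (lam c : ℝ)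
    {Φ : E → ℝ}
    (hΦ : ∀ V, Φ V = (∑ s, ℓ s (∑ k, a s k * π k V)) + lam / 2 * (c + ∑ k, π k V ^ 2))
    {V : E} (h : fderiv ℝ Φ V = 0) (k₀ : ι) (e : E)
    (he : ∀ k, π k e = if k = k₀ then 1 else 0) :
    (∑ s, deriv (ℓ s) (∑ k, a s k * π k V) * a s k₀) + lam * π k₀ V = 0 := by
  simp only [← hπ] at hΦ he ⊢
  have h₁ : ∀ s, HasFDerivAt (fun V => ℓ s (∑ k, a s k * φ k V))
      (deriv (ℓ s) (∑ k, a s k * φ k V) • ∑ k, a s k • φ k) V := fun s =>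
    (hℓ s _).hasDerivAt.comp_hasFDerivAt V
      (HasFDerivAt.fun_sum fun k _ => (φ k).hasFDerivAt.const_mul (a s k))
  have h₂ : HasFDerivAt (fun V => lam / 2 * (c + ∑ k, φ k V ^ 2))
      ((lam / 2) • ∑ k, (2 * φ k V ^ 1) • φ k) V := by
    refine HasFDerivAt.const_mul (HasFDerivAt.const_add c ?_) _
    refine HasFDerivAt.fun_sum fun k _ => ?_
    simpa using (φ k).hasFDerivAt.pow (x := V) 2
  have h₃ := (HasFDerivAt.fun_sum (u := Finset.univ) fun s _ => h₁ s).add h₂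
  rw [show Φ = _ from funext hΦ] at h
  have h₄ := DFunLike.congr_fun (h₃.fderiv.symm.trans h) e
  simp [he] at h₄
  linarith

theorem matrix_eq_of_fderiv_regularized_eq_zero {p q S : ℕ} {ℓ : Fin S → ℝ → ℝ}
    (hℓ : ∀ s, Differentiable ℝ (ℓ s)) {β lam : ℝ} (hlam : lam ≠ 0) (c : ℝ)
    (u : Fin p → ℝ) (y : Fin S → Fin q → ℝ) {Φ : Matrix (Fin p) (Fin q) ℝ → ℝ}
    (hΦ : ∀ V, Φ V = (∑ s, ℓ s (β * (u ⬝ᵥ (V *ᵥ y s)))) +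
      lam / 2 * (c + ∑ i, ∑ j, V i j ^ 2))
    {V : Matrix (Fin p) (Fin q) ℝ} (h : fderiv ℝ Φ V = 0) :
    V = vecMulVec u (-(β / lam) • ∑ s, deriv (ℓ s) (β * (u ⬝ᵥ (V *ᵥ y s))) • y s) := by
  have hlin : ∀ (V : Matrix (Fin p) (Fin q) ℝ) s,
      β * (u ⬝ᵥ (V *ᵥ y s)) = ∑ k : Fin p × Fin q, (β * u k.1 * y s k.2) * V k.1 k.2 := by
    intro V s
    simp only [Fintype.sum_prod_type, dotProduct, mulVec, Finset.mul_sum]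
    exact Finset.sum_congr rfl fun i _ => Finset.sum_congr rfl fun j _ => by ring
  ext i j
  have key := coord_eq_of_fderiv_regularized_eq_zero (ι := Fin p × Fin q)
    (E := Matrix (Fin p) (Fin q) ℝ)
    (fun k => (ContinuousLinearMap.proj (R := ℝ) (φ := fun _ : Fin q => ℝ) k.2).comp
      (ContinuousLinearMap.proj (R := ℝ) (φ := fun _ : Fin p => Fin q → ℝ) k.1))
    (π := fun k V => V k.1 k.2) (fun _ _ => rfl) hℓ
    (fun s k => β * u k.1 * y s k.2) lam c (Φ := Φ)
    (fun V => by rw [hΦ]; simp only [hlin, Fintype.sum_prod_type]) h (i, j)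
    (Matrix.single i j 1) (by
      rintro ⟨i', j'⟩
      simp [Matrix.single_apply, Prod.ext_iff, eq_comm])
  simp only [← hlin] at key
  simp only [vecMulVec_apply, Pi.smul_apply, Finset.sum_apply, smul_eq_mul]
  have hs : ∑ s, deriv (ℓ s) (β * (u ⬝ᵥ (V *ᵥ y s))) * (β * u i * y s j) =
      β * u i * ∑ s, deriv (ℓ s) (β * (u ⬝ᵥ (V *ᵥ y s))) * y s j := by
    rw [Finset.mul_sum]
    exact Finset.sum_congr rfl fun s _ => by ring
  rw [hs] at key
  field_simp
  linarith

theorem vector_eq_of_fderiv_regularized_eq_zero {p S : ℕ} {ℓ : Fin S → ℝ → ℝ}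
    (hℓ : ∀ s, Differentiable ℝ (ℓ s)) {β lam : ℝ} (hlam : lam ≠ 0) (c : ℝ)
    (y : Fin S → Fin p → ℝ) {Φ : (Fin p → ℝ) → ℝ}
    (hΦ : ∀ v, Φ v = (∑ s, ℓ s (β * (v ⬝ᵥ y s))) + lam / 2 * (c + ∑ i, v i ^ 2))
    {v : Fin p → ℝ} (h : fderiv ℝ Φ v = 0) :
    v = -(β / lam) • ∑ s, deriv (ℓ s) (β * (v ⬝ᵥ y s)) • y s := by
  have hlin : ∀ (v : Fin p → ℝ) s, β * (v ⬝ᵥ y s) = ∑ k, (β * y s k) * v k := by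
    intro v s
    simp only [dotProduct, Finset.mul_sum]
    exact Finset.sum_congr rfl fun i _ => by ring
  ext i
  have key := coord_eq_of_fderiv_regularized_eq_zero
    (fun k => ContinuousLinearMap.proj (R := ℝ) (φ := fun _ : Fin p => ℝ) k)
    (π := fun k v => v k) (fun _ _ => rfl) hℓ
    (fun s k => β * y s k) lam c (Φ := Φ)
    (fun v => by rw [hΦ]; simp only [hlin]) h i
    (Pi.single i 1) (fun k => by simp [Pi.single_apply])
  simp only [← hlin] at key
  simp only [Pi.smul_apply, Finset.sum_apply, smul_eq_mul]
  have hs : ∑ s, deriv (ℓ s) (β * (v ⬝ᵥ y s)) * (β * y s i) =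
      β * ∑ s, deriv (ℓ s) (β * (v ⬝ᵥ y s)) * y s i := by
    rw [Finset.mul_sum]
    exact Finset.sum_congr rfl fun s _ => by ring
  rw [hs] at key
  field_simp
  linarith

theorem mulVec_sum_smul {p q σ : Type*} [Fintype q] [Fintype σ] (A : Matrix p q ℝ) (r : σ → ℝ)
    (y : σ → q → ℝ) : ∑ s, r s • (A *ᵥ y s) = A *ᵥ ∑ s, r s • y s := by
  simp only [Matrix.mulVec_sum, Matrix.mulVec_smul]

/-- Deep linear network critical-point recursion: at any critical point of the
`L2`-regularized loss, the backward products satisfy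
`W^L W^{L-1} ⋯ W^l = f̃^{L-l} • (Ŵ^{l-1})ᵀ` for `0 ≤ l ≤ L`, where
`Ŵ^{l-1} = -(β/λ) W^{l-1} ⋯ W⁰ g`, `Ŵ^{-1} = -(β/λ) g`,
`g = ∑ₛ ℓₛ'(f(xₛ)) xₛ` and `f̃ = -(1/λ) ∑ₛ ℓₛ'(f(xₛ)) f(xₛ)`. -/
theorem deep_linear_critical_point_recursion
    (n d L S : ℕ) (hn : 0 < n) (hd : 0 < d) (hL : 1 ≤ L)
    (β lam : ℝ) (hβ : 0 < β) (hlam : 0 < lam)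
    (x : Fin S → Fin d → ℝ) (ℓ : Fin S → ℝ → ℝ) (hℓ : ∀ s, Differentiable ℝ (ℓ s))
    (W0 : Matrix (Fin n) (Fin d) ℝ) (M : ℕ → Matrix (Fin n) (Fin n) ℝ) (wL : Fin n → ℝ)
    (hcrit0 : fderiv ℝ (fun V => deepLinearLoss n d L S β lam x ℓ V M wL) W0 = 0)
    (hcritmid : ∀ l, 1 ≤ l → l ≤ L - 1 →
      fderiv ℝ (fun V => deepLinearLoss n d L S β lam x ℓ W0 (Function.update M l V) wL)
        (M l) = 0)
    (hcritL : fderiv ℝ (fun v => deepLinearLoss n d L S β lam x ℓ W0 M v) wL = 0)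
    (fval : Fin S → ℝ)
    (hfval : fval = fun s => β * (wL ⬝ᵥ (prodSegDL M 1 (L - 1) *ᵥ (W0 *ᵥ x s))))
    (g : Fin d → ℝ) (hgdef : g = ∑ s, deriv (ℓ s) (fval s) • x s)
    (ftil : ℝ) (hftil : ftil = -(1 / lam) * ∑ s, deriv (ℓ s) (fval s) * fval s) :
    (∀ l, 1 ≤ l → l ≤ L →
      wL ᵥ* prodSegDL M l (L - l) =
        ftil ^ (L - l) • ((-(β / lam)) • (prodSegDL M 1 (l - 1) *ᵥ (W0 *ᵥ g)))) ∧
    (wL ᵥ* prodSegDL M 1 (L - 1)) ᵥ* W0 = ftil ^ L • ((-(β / lam)) • g) := by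
  obtain ⟨N, rfl⟩ : ∃ N, L = N + 1 := ⟨L - 1, by omega⟩
  simp only [Nat.add_sub_cancel] at *
  have hlam0 : lam ≠ 0 := hlam.ne'
  have hW0 : W0 = vecMulVec (wL ᵥ* prodSegDL M 1 N) (-(β / lam) • g) := by
    have h := matrix_eq_of_fderiv_regularized_eq_zero hℓ (β := β) hlam0
      ((∑ l ∈ Finset.Icc 1 N, ∑ i, ∑ j, M l i j ^ 2) + ∑ i, wL i ^ 2)
      (wL ᵥ* prodSegDL M 1 N) x (fun V => by
        simp only [deepLinearLoss, Nat.add_sub_cancel, ← dotProduct_mulVec]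
        ring) hcrit0
    simpa only [← dotProduct_mulVec, hgdef, hfval] using h
  have hwL : wL = -(β / lam) • (prodSegDL M 1 N *ᵥ (W0 *ᵥ g)) := by
    have h := vector_eq_of_fderiv_regularized_eq_zero hℓ (β := β) hlam0
      ((∑ i, ∑ j, W0 i j ^ 2) + ∑ l ∈ Finset.Icc 1 N, ∑ i, ∑ j, M l i j ^ 2)
      (fun s => prodSegDL M 1 N *ᵥ (W0 *ᵥ x s)) (fun v => by
        simp only [deepLinearLoss, Nat.add_sub_cancel]) hcritL
    simpa only [mulVec_sum_smul, hgdef, hfval] using h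
  have hM : ∀ k c, k + 1 + c = N → M (k + 1) =
      vecMulVec (wL ᵥ* prodSegDL M (k + 2) c)
        (-(β / lam) • (prodSegDL M 1 k *ᵥ (W0 *ᵥ g))) := by
    intro k c hkc
    have hupd : ∀ V, prodSegDL (Function.update M (k + 1) V) 1 N =
        prodSegDL M (k + 2) c * V * prodSegDL M 1 k := by
      intro V
      have h := prodSegDL_update M V 1 k c
      rwa [hkc, show 1 + k = k + 1 by omega] at h
    have hmem : k + 1 ∈ Finset.Icc 1 N := Finset.mem_Icc.2 ⟨by omega, by omega⟩
    have hprod : prodSegDL M 1 N =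
        prodSegDL M (k + 2) c * M (k + 1) * prodSegDL M 1 k := by
      simpa using hupd (M (k + 1))
    have herase : ∀ V, ∑ l ∈ (Finset.Icc 1 N).erase (k + 1),
        ∑ i, ∑ j, Function.update M (k + 1) V l i j ^ 2 =
        ∑ l ∈ (Finset.Icc 1 N).erase (k + 1), ∑ i, ∑ j, M l i j ^ 2 := fun V =>
      Finset.sum_congr rfl fun l hl => by
        rw [Function.update_of_ne (Finset.ne_of_mem_erase hl)]
    have h := matrix_eq_of_fderiv_regularized_eq_zero hℓ (β := β) hlam0
      ((∑ i, ∑ j, W0 i j ^ 2) +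
        (∑ l ∈ (Finset.Icc 1 N).erase (k + 1), ∑ i, ∑ j, M l i j ^ 2) + ∑ i, wL i ^ 2)
      (wL ᵥ* prodSegDL M (k + 2) c) (fun s => prodSegDL M 1 k *ᵥ (W0 *ᵥ x s)) (fun V => by
        simp only [deepLinearLoss, Nat.add_sub_cancel, ← dotProduct_mulVec, hupd,
          ← Finset.add_sum_erase _ _ hmem, Function.update_self, ← mulVec_mulVec,
          herase]
        ring) (hcritmid (k + 1) (by omega) (by omega))
    simp only [← dotProduct_mulVec, mulVec_sum_smul] at h
    simpa only [hgdef, hfval, hprod, ← mulVec_mulVec] using h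
  have hf : -(β / lam) * (wL ⬝ᵥ (prodSegDL M 1 N *ᵥ (W0 *ᵥ g))) = ftil := by
    have hT : wL ⬝ᵥ (prodSegDL M 1 N *ᵥ (W0 *ᵥ g)) =
        ∑ s, deriv (ℓ s) (fval s) * (wL ⬝ᵥ (prodSegDL M 1 N *ᵥ (W0 *ᵥ x s))) := by
      rw [hgdef, ← mulVec_sum_smul, ← mulVec_sum_smul, dotProduct_sum]
      simp only [dotProduct_smul, smul_eq_mul]
    rw [hT, hftil, Finset.mul_sum, Finset.mul_sum]
    refine Finset.sum_congr rfl fun s _ => ?_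
    rw [show fval s = β * (wL ⬝ᵥ (prodSegDL M 1 N *ᵥ (W0 *ᵥ x s))) from congrFun hfval s]
    ring
  have hsq : ∀ c k, k + c = N →
      wL ᵥ* prodSegDL M (k + 1) c =
        ftil ^ c • (-(β / lam) • (prodSegDL M 1 k *ᵥ (W0 *ᵥ g))) →
      (wL ᵥ* prodSegDL M (k + 1) c) ⬝ᵥ (wL ᵥ* prodSegDL M (k + 1) c) = ftil ^ (c + 1) := by
    intro c k hkc h
    nth_rewrite 2 [h]
    rw [dotProduct_smul, dotProduct_smul, ← dotProduct_mulVec, mulVec_mulVec, add_comm k 1,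
      ← prodSegDL_add, hkc, smul_eq_mul, smul_eq_mul, hf, pow_succ]
  have hrec : ∀ c k, k + c = N → wL ᵥ* prodSegDL M (k + 1) c =
      ftil ^ c • (-(β / lam) • (prodSegDL M 1 k *ᵥ (W0 *ᵥ g))) := by
    intro c
    induction c with
    | zero =>
      rintro k rfl
      simpa [prodSegDL] using hwL
    | succ c ih =>
      intro k hkc
      have h := ih (k + 1) (by omega)
      rw [add_comm c 1, prodSegDL_add, ← vecMul_vecMul]
      have h₁ : prodSegDL M (k + 1) 1 = M (k + 1) := by simp [prodSegDL]
      rw [h₁, hM k c (by omega), vecMul_vecMulVec, hsq c (k + 1) (by omega) h, add_comm 1 c]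
  refine ⟨fun l hl hlL => ?_, ?_⟩
  · obtain ⟨k, rfl⟩ : ∃ k, l = k + 1 := ⟨l - 1, by omega⟩
    simpa using hrec (N - k) k (by omega)
  · nth_rewrite 1 [hW0]
    rw [vecMul_vecMulVec, hsq N 0 (by omega) (hrec N 0 (by omega))]
end

section
/- Two-layer linear network, single sample. Let n be a positive integer and β > 0, λ > 0 reals. For w₁, w₂ ∈ ℝ^n define the network output f = β * ⟨w₂, w₁⟩ and the loss L_tot(w₁, w₂) = ½ (f - 1)² + (λ/2)(‖w₁‖² + ‖w₂‖²) (MSE loss for a single training sample x = 1 with label y = 1). If (w₁, w₂) is a critical point of L_tot with f ≠ 0, then β² * (f - 1)² = λ². In particular, with the NTK normalization β = n^{-1/2}, any nontrivial critical point satisfies λ² * n = (f - 1)², i.e. λ√n = |f - 1|; such a nontrivial fixed point with f bounded away from 0 and 1 exists only when λ²n is of order one. -/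
open RealInnerProductSpace

/-- The derivative of the regularized loss of a two-layer linear network with output
`β * ⟪w.2, w.1⟫`, evaluated at a direction `v`. -/
theorem fderiv_regularized_loss_apply {E : Type*} [NormedAddCommGroup E] [InnerProductSpace ℝ E]
    (β lam : ℝ) (w v : E × E) :
    fderiv ℝ (fun w : E × E =>
      (1 / 2) * (β * ⟪w.2, w.1⟫ - 1) ^ 2 + lam / 2 * (‖w.1‖ ^ 2 + ‖w.2‖ ^ 2)) w v =
      (β * ⟪w.2, w.1⟫ - 1) * (β * (⟪w.2, v.1⟫ + ⟪v.2, w.1⟫)) +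
        lam * (⟪w.1, v.1⟫ + ⟪w.2, v.2⟫) := by
  have h₁ : HasFDerivAt (fun w : E × E => w.1) (ContinuousLinearMap.fst ℝ E E) w :=
    hasFDerivAt_fst
  have h₂ : HasFDerivAt (fun w : E × E => w.2) (ContinuousLinearMap.snd ℝ E E) w :=
    hasFDerivAt_snd
  have h := (((((h₂.inner ℝ h₁).const_mul β).sub_const 1).pow 2).const_mul (1 / 2)).add
    ((h₁.norm_sq.add h₂.norm_sq).const_mul (lam / 2))
  refine (congrArg (fun L => L v) h.fderiv).trans ?_
  simp
  ring

/-- Two-layer linear network with a single training sample `x = 1`, label `y = 1`: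
any critical point of `L_tot(w₁,w₂) = ½(β⟨w₂,w₁⟩ - 1)² + (λ/2)(‖w₁‖² + ‖w₂‖²)` with
nonzero output `f = β⟨w₂,w₁⟩` satisfies `β²(f-1)² = λ²`; in particular with the NTK
normalization `β = n^{-1/2}` it satisfies `λ²n = (f-1)²`, i.e. `λ√n = |f-1|`. -/
theorem two_layer_linear_critical_point
    (n : ℕ) (hn : 0 < n) (β lam : ℝ) (hβ : 0 < β) (hlam : 0 < lam)
    (w₁ w₂ : EuclideanSpace ℝ (Fin n))
    (Ltot : EuclideanSpace ℝ (Fin n) × EuclideanSpace ℝ (Fin n) → ℝ)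
    (hLtot : Ltot = fun w =>
      (1 / 2) * (β * ⟪w.2, w.1⟫ - 1) ^ 2 + lam / 2 * (‖w.1‖ ^ 2 + ‖w.2‖ ^ 2))
    (hcrit : fderiv ℝ Ltot (w₁, w₂) = 0)
    (f : ℝ) (hf : f = β * ⟪w₂, w₁⟫) (hfne : f ≠ 0) :
    β ^ 2 * (f - 1) ^ 2 = lam ^ 2 ∧
      (β = (Real.sqrt n)⁻¹ →
        lam ^ 2 * n = (f - 1) ^ 2 ∧ lam * Real.sqrt n = |f - 1|) := by
  subst hLtot
  have crit : ∀ v : EuclideanSpace ℝ (Fin n) × EuclideanSpace ℝ (Fin n),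
      (f - 1) * (β * (⟪w₂, v.1⟫ + ⟪v.2, w₁⟫)) +
        lam * (⟪w₁, v.1⟫ + ⟪w₂, v.2⟫) = 0 := fun v => by
    have h := fderiv_regularized_loss_apply β lam (w₁, w₂) v
    rw [hcrit] at h
    simpa [hf] using h.symm
  have h₁ := crit (w₂, 0)
  have h₂ := crit (0, w₂)
  simp only [inner_zero_left, inner_zero_right, add_zero, zero_add,
    real_inner_comm w₂ w₁] at h₁ h₂
  have key : β ^ 2 * (f - 1) ^ 2 = lam ^ 2 := by
    refine mul_right_cancel₀ hfne ?_
    linear_combination β ^ 2 * (f - 1) * h₂ - lam * β * h₁ +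
      (β ^ 2 * (f - 1) ^ 2 - lam ^ 2) * hf
  refine ⟨key, fun hβn => ?_⟩
  have hn' : (0 : ℝ) < n := Nat.cast_pos.mpr hn
  have hsq : lam ^ 2 * n = (f - 1) ^ 2 := by
    rw [← key, hβn, inv_pow, Real.sq_sqrt hn'.le]
    field_simp
  refine ⟨hsq, ?_⟩
  rw [← Real.sqrt_sq_eq_abs, ← hsq, Real.sqrt_mul (sq_nonneg _), Real.sqrt_sq hlam.le]
end
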